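/- There is no quantum channel on one qubit producing two output qubits, given in Kraus form, whose action on the planar-state family factors as a product of two non-constant one-qubit density-matrix families. Precisely: there do not exist n ∈ ℕ, Kraus operators K : Fin n → Matrix (Fin 2 × Fin 2) (Fin 2) ℂ with ∑_i (K i)ᴴ * (K i) = 1, and functions ρ₁, ρ₂ : ℝ → Matrix (Fin 2) (Fin 2) ℂ such that each ρ₁(θ) and ρ₂(θ) is Hermitian, positive semidefinite and of trace 1, ∑_i (K i) * |+_θ⟩⟨+_θ| * (K i)ᴴ = ρ₁(θ) ⊗ ρ₂(θ) (Kronecker product) for all θ ∈ ℝ, and both ρ₁ and ρ₂ are non-constant functions of θ. -/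

import Mathlib

open Matrix ComplexOrder

/-- The planar state `|+_θ⟩ = (1/√2)(e₀ + e^{iθ} e₁)` in `Fin 2 → ℂ`. -/
noncomputable def plus (θ : ℝ) : Fin 2 → ℂ :=
  fun i => (1 / Real.sqrt 2 : ℂ) * Complex.exp (θ * Complex.I) ^ (i : ℕ)

/-- The rank-one density matrix `|+_θ⟩⟨+_θ|`. -/
noncomputable def plusOuter (θ : ℝ) : Matrix (Fin 2) (Fin 2) ℂ :=
  Matrix.of fun i j => plus θ i * star (plus θ j)

theorem exp_mul_I_mul_star (θ : ℝ) :
    Complex.exp (θ * Complex.I) * star (Complex.exp (θ * Complex.I)) = 1 := by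
  rw [Complex.star_def, Complex.mul_conj, Complex.normSq_eq_norm_sq,
    Complex.norm_exp_ofReal_mul_I]
  simp

theorem trig_second_coeff_eq_zero {α β γ δ ε : ℂ}
    (h : ∀ θ : ℝ, α + β * Complex.exp (θ * Complex.I) + γ * star (Complex.exp (θ * Complex.I)) +
      δ * Complex.exp (θ * Complex.I) ^ 2 + ε * star (Complex.exp (θ * Complex.I)) ^ 2 = 0) :
    δ = 0 := by
  have unit_circle : ∀ z : ℂ, ‖z‖ = 1 → α + β * z + γ * star z + δ * z ^ 2 + ε * star z ^ 2 = 0 := by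
    intro z hz
    have hz' : Complex.exp (z.arg * Complex.I) = z := by
      simpa [hz] using Complex.norm_mul_exp_arg_mul_I z
    simpa only [hz'] using h z.arg
  set w := Complex.exp ((Real.pi / 4 : ℝ) * Complex.I) with hw
  have norm_w : ‖w‖ = 1 := Complex.norm_exp_ofReal_mul_I _
  have w_sq : w ^ 2 = Complex.I := by
    have angle : ((2 : ℕ) : ℂ) * ((Real.pi / 4 : ℝ) * Complex.I) = Real.pi / 2 * Complex.I := by
      push_cast
      ring
    rw [hw, ← Complex.exp_nat_mul, angle, Complex.exp_pi_div_two_mul_I]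
  have star_w_sq : star w ^ 2 = -Complex.I := by
    rw [← star_pow, w_sq]
    simp
  have h₁ := unit_circle 1 (by simp)
  have h₂ := unit_circle (-1) (by simp)
  have h₃ := unit_circle Complex.I (by simp)
  have h₄ := unit_circle (-Complex.I) (by simp)
  have h₅ := unit_circle w norm_w
  have h₆ := unit_circle (-w) (by simpa using norm_w)
  simp only [star_neg, star_one, neg_sq, w_sq, Complex.I_sq, Complex.star_def,
    Complex.conj_I] at h₁ h₂ h₃ h₄ h₅ h₆
  rw [← Complex.star_def, star_w_sq] at h₅ h₆
  linear_combination 1 / 8 * (h₁ + h₂) - 1 / 8 * (h₃ + h₄)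
    - Complex.I / 4 * (h₅ + h₆) + Complex.I / 8 * (h₁ + h₂ + h₃ + h₄)
    + (δ - ε) / 2 * Complex.I_sq

theorem plusOuter_eq (θ : ℝ) :
    plusOuter θ = (1 / 2 : ℂ) • (1 : Matrix (Fin 2) (Fin 2) ℂ) +
      Complex.exp (θ * Complex.I) • Matrix.single 1 0 (1 / 2 : ℂ) +
      star (Complex.exp (θ * Complex.I)) • (Matrix.single 1 0 (1 / 2 : ℂ))ᴴ := by
  have sqrt_mul : ((Real.sqrt 2 : ℝ) : ℂ)⁻¹ * ((Real.sqrt 2 : ℝ) : ℂ)⁻¹ = 1 / 2 := by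
    rw [← mul_inv, ← Complex.ofReal_mul, Real.mul_self_sqrt (by norm_num)]
    norm_num
  have exp_mul_star := exp_mul_I_mul_star θ
  set z := Complex.exp (θ * Complex.I) with hz
  ext i j
  fin_cases i <;> fin_cases j <;>
    simp [plusOuter, plus, ← hz] at exp_mul_star ⊢
  · linear_combination sqrt_mul
  · linear_combination (starRingEnd ℂ) z * sqrt_mul
  · linear_combination z * sqrt_mul
  · linear_combination sqrt_mul + ((Real.sqrt 2 : ℝ) : ℂ)⁻¹ * ((Real.sqrt 2 : ℝ) : ℂ)⁻¹ * exp_mul_star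

theorem exists_kraus_plusOuter_eq {m ι : Type*} [Fintype ι]
    (K : ι → Matrix m (Fin 2) ℂ) :
    ∃ A B : Matrix m m ℂ, ∀ θ : ℝ, ∑ i, K i * plusOuter θ * (K i)ᴴ =
      A + Complex.exp (θ * Complex.I) • B + star (Complex.exp (θ * Complex.I)) • Bᴴ := by
  refine ⟨∑ i, K i * ((1 / 2 : ℂ) • (1 : Matrix (Fin 2) (Fin 2) ℂ)) * (K i)ᴴ,
    ∑ i, K i * (Matrix.single 1 0 (1 / 2) : Matrix (Fin 2) (Fin 2) ℂ) * (K i)ᴴ, fun θ => ?_⟩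
  rw [Matrix.conjTranspose_sum, Finset.smul_sum, Finset.smul_sum, ← Finset.sum_add_distrib,
    ← Finset.sum_add_distrib]
  refine Finset.sum_congr rfl fun i _ => ?_
  rw [plusOuter_eq]
  simp only [Matrix.mul_add, Matrix.add_mul, Matrix.mul_smul, Matrix.smul_mul,
    Matrix.conjTranspose_mul, Matrix.conjTranspose_conjTranspose, Matrix.mul_assoc]

theorem exists_coeff_ne_zero_of_nonconstant {m : Type*} {ρ : ℝ → Matrix m m ℂ} {a b : Matrix m m ℂ}
    (h : ∀ θ : ℝ, ρ θ =
      a + Complex.exp (θ * Complex.I) • b + star (Complex.exp (θ * Complex.I)) • bᴴ)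
    (hρ : ∃ θ θ' : ℝ, ρ θ ≠ ρ θ') : ∃ i j, b i j ≠ 0 := by
  by_contra! hb
  have b_eq : b = 0 := by
    ext i j
    exact hb i j
  obtain ⟨θ, θ', hne⟩ := hρ
  exact hne (by simp [h, b_eq])

/-- No quantum channel (in Kraus form) from one qubit to two qubits maps the
planar-state family to a product `ρ₁(θ) ⊗ ρ₂(θ)` of two non-constant
one-qubit density-matrix families. -/
theorem no_product_channel :
    ¬ ∃ (n : ℕ) (K : Fin n → Matrix (Fin 2 × Fin 2) (Fin 2) ℂ)
        (ρ₁ ρ₂ : ℝ → Matrix (Fin 2) (Fin 2) ℂ),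
      (∑ i, (K i)ᴴ * K i = 1) ∧
      (∀ θ : ℝ, (ρ₁ θ).IsHermitian ∧ (ρ₁ θ).PosSemidef ∧ (ρ₁ θ).trace = 1) ∧
      (∀ θ : ℝ, (ρ₂ θ).IsHermitian ∧ (ρ₂ θ).PosSemidef ∧ (ρ₂ θ).trace = 1) ∧
      (∀ θ : ℝ, ∑ i, K i * plusOuter θ * (K i)ᴴ =
        Matrix.kroneckerMap (· * ·) (ρ₁ θ) (ρ₂ θ)) ∧
      (∃ θ θ' : ℝ, ρ₁ θ ≠ ρ₁ θ') ∧
      (∃ θ θ' : ℝ, ρ₂ θ ≠ ρ₂ θ') := by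
  rintro ⟨n, K, ρ₁, ρ₂, -, hρ₁, hρ₂, hK, hne₁, hne₂⟩
  obtain ⟨A, B, hAB⟩ := exists_kraus_plusOuter_eq K
  have entry (θ : ℝ) (i j k l : Fin 2) : ρ₁ θ i j * ρ₂ θ k l =
      A (i, k) (j, l) + Complex.exp (θ * Complex.I) * B (i, k) (j, l) +
        star (Complex.exp (θ * Complex.I)) * star (B (j, l) (i, k)) := by
    have := congrFun (congrFun ((hK θ).symm.trans (hAB θ)) (i, k)) (j, l)
    simpa [Matrix.kroneckerMap_apply, Matrix.conjTranspose_apply] using this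
  have marginal₁ (θ : ℝ) : ρ₁ θ = Matrix.of (fun i j => ∑ k, A (i, k) (j, k)) +
      Complex.exp (θ * Complex.I) • Matrix.of (fun i j => ∑ k, B (i, k) (j, k)) +
      star (Complex.exp (θ * Complex.I)) • (Matrix.of (fun i j => ∑ k, B (i, k) (j, k)))ᴴ := by
    ext i j
    have tr := (hρ₂ θ).2.2
    rw [Matrix.trace_fin_two] at tr
    simp only [Matrix.add_apply, Matrix.smul_apply, Matrix.conjTranspose_apply, Matrix.of_apply,
      Fin.sum_univ_two, smul_eq_mul, star_add]
    linear_combination entry θ i j 0 0 + entry θ i j 1 1 - ρ₁ θ i j * tr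
  have marginal₂ (θ : ℝ) : ρ₂ θ = Matrix.of (fun k l => ∑ i, A (i, k) (i, l)) +
      Complex.exp (θ * Complex.I) • Matrix.of (fun k l => ∑ i, B (i, k) (i, l)) +
      star (Complex.exp (θ * Complex.I)) • (Matrix.of (fun k l => ∑ i, B (i, k) (i, l)))ᴴ := by
    ext k l
    have tr := (hρ₁ θ).2.2
    rw [Matrix.trace_fin_two] at tr
    simp only [Matrix.add_apply, Matrix.smul_apply, Matrix.conjTranspose_apply, Matrix.of_apply,
      Fin.sum_univ_two, smul_eq_mul, star_add]
    linear_combination entry θ 0 0 k l + entry θ 1 1 k l - ρ₂ θ k l * tr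
  obtain ⟨i, j, hb⟩ := exists_coeff_ne_zero_of_nonconstant marginal₁ hne₁
  obtain ⟨k, l, hd⟩ := exists_coeff_ne_zero_of_nonconstant marginal₂ hne₂
  generalize Matrix.of (fun i j => ∑ k, A (i, k) (j, k)) = a at marginal₁
  generalize Matrix.of (fun i j => ∑ k, B (i, k) (j, k)) = b at marginal₁ hb
  generalize Matrix.of (fun k l => ∑ i, A (i, k) (i, l)) = c at marginal₂
  generalize Matrix.of (fun k l => ∑ i, B (i, k) (i, l)) = d at marginal₂ hd
  refine mul_ne_zero hb hd (trig_second_coeff_eq_zero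
    (α := a i j * c k l + b i j * star (d l k) + star (b j i) * d k l - A (i, k) (j, l))
    (β := a i j * d k l + b i j * c k l - B (i, k) (j, l))
    (γ := a i j * star (d l k) + star (b j i) * c k l - star (B (j, l) (i, k)))
    (ε := star (b j i) * star (d l k)) fun θ => ?_)
  have product := entry θ i j k l
  rw [marginal₁ θ, marginal₂ θ] at product
  simp only [Matrix.add_apply, Matrix.smul_apply, Matrix.conjTranspose_apply,
    smul_eq_mul] at product
  linear_combination product -
    (b i j * star (d l k) + star (b j i) * d k l) * exp_mul_I_mul_star θ
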